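/- arXiv:2305.02850 — 2 statements merged into one kernel-verified Lean document; each statement's English description precedes it below -/
import Mathlib

section
/- For every integer k ≥ 3 and every function p : ℕ → ℕ, there exist sequences h_1,…,h_k and w_1,…,w_k of positive reals such that: the partition C = (C_1,…,C_k) achieves the minimum weighted k-median cost among all partitions of the 2k weighted points of X(w,h) into at most k clusters, and every partition of the 2k weighted points into at most k clusters other than C has weighted k-median cost at least p(2k) times the weighted k-median cost of C. -/
noncomputable section

attribute [local instance] Classical.propDecidable

/-- A threshold decision tree over `ℝ^d`: every internal node is labeled by a
coordinate index and a real threshold. -/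
inductive TDT (d : ℕ) : Type
  | leaf : TDT d
  | node (r : Fin d) (θ : ℝ) (left right : TDT d) : TDT d

namespace TDT

/-- The number of leaves of a threshold decision tree. -/
def leaves {d : ℕ} : TDT d → ℕ
  | leaf => 1
  | node _ _ l r => l.leaves + r.leaves

/-- The depth of a threshold decision tree: the maximum number of internal nodes
on a root-to-leaf path. -/
def depth {d : ℕ} : TDT d → ℕ
  | leaf => 0
  | node _ _ l r => max l.depth r.depth + 1

/-- The index (numbering leaves from left to right) of the leaf a point is routed to:
at a node labeled `(r, θ)` the point goes left when its `r`-th coordinate is `< θ`,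
and right otherwise. -/
def route {d : ℕ} : TDT d → EuclideanSpace ℝ (Fin d) → ℕ
  | leaf, _ => 0
  | node r θ l rt, x => if x r < θ then l.route x else l.leaves + rt.route x

/-- The clustering of a finite multiset induced by a threshold decision tree:
the partition of `X` into the nonempty fibers of `route` (points routed to the
same leaf form one cluster). -/
def clustering {d : ℕ} (t : TDT d) (X : Multiset (EuclideanSpace ℝ (Fin d))) :
    Multiset (Multiset (EuclideanSpace ℝ (Fin d))) :=
  Multiset.filter (fun C => C ≠ 0)
    ((Finset.range t.leaves).val.map fun i => X.filter fun x => t.route x = i)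

end TDT

/-- `P` is a partition of the multiset `X` into at most `k` nonempty clusters. -/
def IsClustering {d : ℕ} (X : Multiset (EuclideanSpace ℝ (Fin d))) (k : ℕ)
    (P : Multiset (Multiset (EuclideanSpace ℝ (Fin d)))) : Prop :=
  P.sum = X ∧ Multiset.card P ≤ k ∧ (0 : Multiset (EuclideanSpace ℝ (Fin d))) ∉ P

/-- The `1`-means cost of a single cluster: `inf_c Σ_{x ∈ C} ‖x - c‖²`. -/
def costMeans1 {d : ℕ} (C : Multiset (EuclideanSpace ℝ (Fin d))) : ℝ :=
  ⨅ c : EuclideanSpace ℝ (Fin d), (C.map fun x => ‖x - c‖ ^ 2).sum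

/-- The k-means cost of a partition. -/
def costMeans {d : ℕ} (P : Multiset (Multiset (EuclideanSpace ℝ (Fin d)))) : ℝ :=
  (P.map costMeans1).sum

/-- The `1`-median cost of a single cluster: `inf_c Σ_{x ∈ C} ‖x - c‖`. -/
def costMedian1 {d : ℕ} (C : Multiset (EuclideanSpace ℝ (Fin d))) : ℝ :=
  ⨅ c : EuclideanSpace ℝ (Fin d), (C.map fun x => ‖x - c‖).sum

/-- The k-median cost of a partition. -/
def costMedian {d : ℕ} (P : Multiset (Multiset (EuclideanSpace ℝ (Fin d)))) : ℝ :=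
  (P.map costMedian1).sum

/-- The `1`-center cost of a single cluster: `inf_c max_{x ∈ C} ‖x - c‖`. -/
def costCenter1 {d : ℕ} (C : Multiset (EuclideanSpace ℝ (Fin d))) : ℝ :=
  ⨅ c : EuclideanSpace ℝ (Fin d), sSup ((fun x => ‖x - c‖) '' {x | x ∈ C})

/-- The k-center cost of a partition: the maximum over clusters of the `1`-center cost. -/
def costCenter {d : ℕ} (P : Multiset (Multiset (EuclideanSpace ℝ (Fin d)))) : ℝ :=
  sSup (costCenter1 '' {C | C ∈ P})

/-- The optimal k-means cost of `X` over all partitions into at most `k` clusters. -/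
def optMeans {d : ℕ} (X : Multiset (EuclideanSpace ℝ (Fin d))) (k : ℕ) : ℝ :=
  sInf {r : ℝ | ∃ P, IsClustering X k P ∧ r = costMeans P}

/-- The optimal k-median cost of `X` over all partitions into at most `k` clusters. -/
def optMedian {d : ℕ} (X : Multiset (EuclideanSpace ℝ (Fin d))) (k : ℕ) : ℝ :=
  sInf {r : ℝ | ∃ P, IsClustering X k P ∧ r = costMedian P}

/-- The optimal k-center cost of `X` over all partitions into at most `k` clusters. -/
def optCenter {d : ℕ} (X : Multiset (EuclideanSpace ℝ (Fin d))) (k : ℕ) : ℝ :=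
  sInf {r : ℝ | ∃ P, IsClustering X k P ∧ r = costCenter P}

/-! ### The high-dimensional point-set `X(n, ε, d)` -/

/-- The sign `1` or `-1` encoded by a boolean. -/
def sgn (b : Bool) : ℝ := if b then 1 else -1

/-- The point `a·e_i + ε·b·e_j` (with signs `a, b` encoded by booleans). -/
def hdPoint (d : ℕ) (ε : ℝ) (i j : Fin d) (a b : Bool) : EuclideanSpace ℝ (Fin d) :=
  EuclideanSpace.single i (sgn a) + EuclideanSpace.single j (ε * sgn b)

/-- The ε-ball `B_i^a`: `n` copies of `a·e_i + ε·b·e_j` for all `j` and signs `b`. -/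
def epsBall (n d : ℕ) (ε : ℝ) (i : Fin d) (a : Bool) : Multiset (EuclideanSpace ℝ (Fin d)) :=
  (Finset.univ : Finset (Fin d × Bool)).val.bind fun jb =>
    Multiset.replicate n (hdPoint d ε i jb.1 a jb.2)

/-- The partition `C` of `X(n, ε, d)` into the `2d` ε-balls `B_i^a`. -/
def XhdPartition (n d : ℕ) (ε : ℝ) : Multiset (Multiset (EuclideanSpace ℝ (Fin d))) :=
  (Finset.univ : Finset (Fin d × Bool)).val.map fun ia => epsBall n d ε ia.1 ia.2

/-- The multiset `X(n, ε, d)`: `n` copies of `a·e_i + ε·b·e_j` for all `i, j ∈ [d]`,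
`a, b ∈ {1, -1}`; it has `4nd²` points counted with multiplicity. -/
def Xhd (n d : ℕ) (ε : ℝ) : Multiset (EuclideanSpace ℝ (Fin d)) :=
  (XhdPartition n d ε).sum

/-! ### The weighted planar point-set `X(w, h)` -/

/-- A pair of reals viewed as a point of the Euclidean plane. -/
def toE2 (q : ℝ × ℝ) : EuclideanSpace ℝ (Fin 2) :=
  (WithLp.equiv 2 (Fin 2 → ℝ)).symm ![q.1, q.2]

/-- `planarP h i = (p_i^1, p_i^2)`, the two points of the `i`-th cluster of the
weighted planar point-set `X(w, h)` (positions depend only on `h`). -/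
def planarP (h : ℕ → ℝ) : ℕ → (ℝ × ℝ) × (ℝ × ℝ)
  | 0 => ((0, 0), (0, 0))
  | 1 => ((0, 0), (0, 0))
  | 2 => ((h 2, 0), (h 2, 0))
  | i + 3 =>
      let q := planarP h (i + 1)
      let q' := planarP h (i + 2)
      if (i + 3) % 2 = 1 then
        ((q.1.1 - 1, q.1.2 + h (i + 3)), (q'.2.1 + 1, q.2.2 + h (i + 3)))
      else
        ((q.1.1 + h (i + 3), q.1.2 - 1), (q.2.1 + h (i + 3), q'.2.2 + 1))

/-- The position of the weighted point indexed by `(i, a) : Fin k × Fin 2`,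
i.e. `p_{i+1}^{a+1}`. -/
def wpt (k : ℕ) (h : ℕ → ℝ) (x : Fin k × Fin 2) : EuclideanSpace ℝ (Fin 2) :=
  toE2 (if x.2 = (0 : Fin 2) then (planarP h ((x.1 : ℕ) + 1)).1
        else (planarP h ((x.1 : ℕ) + 1)).2)

/-- `P` is a partition of the index set of the `2k` weighted points into at most `k`
nonempty clusters. -/
def IsIdxPartition (k : ℕ) (P : Finset (Finset (Fin k × Fin 2))) : Prop :=
  P.card ≤ k ∧ (∀ S ∈ P, S.Nonempty) ∧
    ∀ x : Fin k × Fin 2, ∃! S : Finset (Fin k × Fin 2), S ∈ P ∧ x ∈ S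

/-- The weighted k-means cost of a partition of the index set of `X(w, h)`. -/
def wCostMeans (k : ℕ) (h w : ℕ → ℝ) (P : Finset (Finset (Fin k × Fin 2))) : ℝ :=
  ∑ S ∈ P, ⨅ c : EuclideanSpace ℝ (Fin 2),
    ∑ x ∈ S, w ((x.1 : ℕ) + 1) * ‖wpt k h x - c‖ ^ 2

/-- The weighted k-median cost of a partition of the index set of `X(w, h)`. -/
def wCostMedian (k : ℕ) (h w : ℕ → ℝ) (P : Finset (Finset (Fin k × Fin 2))) : ℝ :=
  ∑ S ∈ P, ⨅ c : EuclideanSpace ℝ (Fin 2),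
    ∑ x ∈ S, w ((x.1 : ℕ) + 1) * ‖wpt k h x - c‖

/-- The minimum weighted k-means cost over all partitions of the `2k` weighted points
into at most `k` clusters. -/
def wOptMeans (k : ℕ) (h w : ℕ → ℝ) : ℝ :=
  sInf {r : ℝ | ∃ P, IsIdxPartition k P ∧ r = wCostMeans k h w P}

/-- The minimum weighted k-median cost over all partitions of the `2k` weighted points
into at most `k` clusters. -/
def wOptMedian (k : ℕ) (h w : ℕ → ℝ) : ℝ :=
  sInf {r : ℝ | ∃ P, IsIdxPartition k P ∧ r = wCostMedian k h w P}

/-- The canonical partition `C = (C_1, …, C_k)` of the index set, where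
`C_i = {p_i^1, p_i^2}`. -/
def wCanonical (k : ℕ) : Finset (Finset (Fin k × Fin 2)) :=
  (Finset.univ : Finset (Fin k)).image fun i =>
    Finset.univ.filter fun x : Fin k × Fin 2 => x.1 = i

/-- The partition of the index set of the `2k` weighted points induced by a threshold
decision tree (nonempty fibers of the routing of the corresponding positions). -/
def treeIdxPartition (k : ℕ) (t : TDT 2) (h : ℕ → ℝ) : Finset (Finset (Fin k × Fin 2)) :=
  Finset.filter (fun S => S.Nonempty)
    ((Finset.range t.leaves).image fun ℓ =>
      Finset.univ.filter fun x : Fin k × Fin 2 => t.route (wpt k h x) = ℓ)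

/-! ### The planar point-set `Y_k` for k-center -/

/-- The four points of the first cluster of `Y_k`. -/
def Ybase1 : Fin 4 → ℝ × ℝ := ![(-1, 0), (-1.5, 0.5), (-1, 1), (-0.5, 0.5)]

/-- The four points of the second cluster of `Y_k`. -/
def Ybase2 : Fin 4 → ℝ × ℝ := ![(1, 0), (0.5, 0.5), (1, 1), (1.5, 0.5)]

/-- `Ypt i a = p_i^{a+1}`, the `a`-th point of the `i`-th cluster of `Y_k`. -/
def Ypt : ℕ → Fin 4 → ℝ × ℝ
  | 0, _ => (0, 0)
  | 1, a => Ybase1 a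
  | 2, a => Ybase2 a
  | 3, a => Ybase1 a + (1, 2)
  | 4, a => Ybase2 a + (2, 1)
  | i + 5, a => Ypt (i + 3) a + (2, 2)

/-- The cluster `C_i = {p_i^1, p_i^2, p_i^3, p_i^4}` of `Y_k`. -/
def Ycluster (i : ℕ) : Multiset (EuclideanSpace ℝ (Fin 2)) :=
  (Finset.univ : Finset (Fin 4)).val.map fun a => toE2 (Ypt i a)

/-- The partition `C = (C_1, …, C_k)` of `Y_k`. -/
def Ypartition (k : ℕ) : Multiset (Multiset (EuclideanSpace ℝ (Fin 2))) :=
  (Finset.range k).val.map fun i => Ycluster (i + 1)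

/-- The point-set `Y_k` (as a multiset of `4k` points in the plane). -/
def Yset (k : ℕ) : Multiset (EuclideanSpace ℝ (Fin 2)) := (Ypartition k).sum


/-- The sum of `h i`, `h (i - 2)`, `h (i - 4)`, … down to index at least `2`. -/
def paritySum (h : ℕ → ℝ) : ℕ → ℝ
  | 0 => 0
  | 1 => 0
  | n + 2 => paritySum h n + h (n + 2)

lemma paritySum_nonneg {h : ℕ → ℝ} (hh : ∀ i, 0 ≤ h i) : ∀ n, 0 ≤ paritySum h n
  | 0 => le_rfl
  | 1 => le_rfl
  | n + 2 => add_nonneg (paritySum_nonneg hh n) (hh _)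

lemma paritySum_le_add_two_mul {h : ℕ → ℝ} (hh : ∀ i, 0 ≤ h i) (n m : ℕ) :
    paritySum h n ≤ paritySum h (n + 2 * m) := by
  induction m with
  | zero => simp
  | succ m ih =>
    have : paritySum h (n + 2 * (m + 1)) = paritySum h (n + 2 * m) + h (n + 2 * m + 2) := rfl
    linarith [hh (n + 2 * m + 2)]

lemma paritySum_pow_le {B : ℝ} (hB : 1 ≤ B) : ∀ n : ℕ, paritySum (fun i => B ^ i) n ≤ n * B ^ n
  | 0 => by simp [paritySum]
  | 1 => by simp [paritySum]; linarith
  | n + 2 => by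
    have ih := paritySum_pow_le hB n
    have h1 : B ^ n ≤ B ^ (n + 2) := pow_le_pow_right₀ hB (by omega)
    have h2 : (n : ℝ) * B ^ n ≤ n * B ^ (n + 2) := by gcongr
    have h3 : 0 ≤ B ^ (n + 2) := by positivity
    simp only [paritySum]
    push_cast
    linarith

/-- One coordinate of `p_i^1` and `p_i^2` (the second for odd `i`, the first for even `i`) is the
parity sum; the other one is controlled by the previous parity sum. -/
lemma planarP_bounds {h : ℕ → ℝ} (hh : ∀ i, 0 ≤ h i) : ∀ n : ℕ,
    ((n + 1) % 2 = 1 →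
      (planarP h (n + 1)).1.2 = paritySum h (n + 1) ∧
      (planarP h (n + 1)).2.2 = paritySum h (n + 1) ∧
      -((n : ℝ) + 1) ≤ (planarP h (n + 1)).1.1 ∧ (planarP h (n + 1)).1.1 ≤ 0 ∧
      0 ≤ (planarP h (n + 1)).2.1 ∧ (planarP h (n + 1)).2.1 ≤ paritySum h n + 1) ∧
    ((n + 1) % 2 = 0 →
      (planarP h (n + 1)).1.1 = paritySum h (n + 1) ∧
      (planarP h (n + 1)).2.1 = paritySum h (n + 1) ∧
      -((n : ℝ) + 1) ≤ (planarP h (n + 1)).1.2 ∧ (planarP h (n + 1)).1.2 ≤ 0 ∧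
      0 ≤ (planarP h (n + 1)).2.2 ∧ (planarP h (n + 1)).2.2 ≤ paritySum h n + 1)
  | 0 => by simp [planarP, paritySum]
  | 1 => by simp [planarP, paritySum]
  | n + 2 => by
    have ih := planarP_bounds hh n
    have ih' := planarP_bounds hh (n + 1)
    have h0 := paritySum_nonneg hh (n + 2)
    constructor <;> intro hn
    · obtain ⟨a1, a2, a3, a4, a5, a6⟩ := ih.1 (by omega)
      obtain ⟨b1, b2, b3, b4, b5, b6⟩ := ih'.2 (by omega)
      have e : planarP h (n + 2 + 1) =
          (((planarP h (n + 1)).1.1 - 1, (planarP h (n + 1)).1.2 + h (n + 3)),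
            ((planarP h (n + 2)).2.1 + 1, (planarP h (n + 1)).2.2 + h (n + 3))) := by
        rw [planarP, if_pos (by omega)]
      have e' : paritySum h (n + 2 + 1) = paritySum h (n + 1) + h (n + 3) := rfl
      rw [e, e']
      push_cast
      refine ⟨?_, ?_, ?_, ?_, ?_, ?_⟩ <;> linarith
    · obtain ⟨a1, a2, a3, a4, a5, a6⟩ := ih.2 (by omega)
      obtain ⟨b1, b2, b3, b4, b5, b6⟩ := ih'.1 (by omega)
      have e : planarP h (n + 2 + 1) =
          (((planarP h (n + 1)).1.1 + h (n + 3), (planarP h (n + 1)).1.2 - 1),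
            ((planarP h (n + 1)).2.1 + h (n + 3), (planarP h (n + 2)).2.2 + 1)) := by
        rw [planarP, if_neg (by omega)]
      have e' : paritySum h (n + 2 + 1) = paritySum h (n + 1) + h (n + 3) := rfl
      rw [e, e']
      push_cast
      refine ⟨?_, ?_, ?_, ?_, ?_, ?_⟩ <;> linarith

@[simp] lemma toE2_apply_zero (q : ℝ × ℝ) : toE2 q 0 = q.1 := rfl

@[simp] lemma toE2_apply_one (q : ℝ × ℝ) : toE2 q 1 = q.2 := rfl

/-- The two points of one cluster are close to each other. -/
lemma norm_planarP_sub_le {h : ℕ → ℝ} (hh : ∀ i, 0 ≤ h i) (n : ℕ) :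
    ‖toE2 (planarP h (n + 1)).1 - toE2 (planarP h (n + 1)).2‖ ≤ paritySum h n + 1 + (n + 1) := by
  have h0 := paritySum_nonneg hh n
  have hn : (0 : ℝ) ≤ n := n.cast_nonneg
  obtain ⟨ho, he⟩ := planarP_bounds hh n
  rw [EuclideanSpace.norm_eq]
  refine Real.sqrt_le_iff.2 ⟨by linarith, ?_⟩
  simp only [Fin.sum_univ_two, PiLp.sub_apply, toE2_apply_zero, toE2_apply_one, Real.norm_eq_abs,
    sq_abs]
  rcases Nat.mod_two_eq_zero_or_one (n + 1) with hn' | hn'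
  · obtain ⟨a1, a2, a3, a4, a5, a6⟩ := he hn'
    rw [a1, a2, sub_self, zero_pow two_ne_zero, zero_add]
    exact sq_le_sq' (by linarith) (by linarith)
  · obtain ⟨a1, a2, a3, a4, a5, a6⟩ := ho hn'
    rw [a1, a2, sub_self, zero_pow two_ne_zero, add_zero]
    exact sq_le_sq' (by linarith) (by linarith)

/-- Points of different clusters are far from each other. -/
lemma le_norm_wpt_sub {k : ℕ} {h : ℕ → ℝ} (hh : ∀ i, 0 ≤ h i) {x y : Fin k × Fin 2}
    (hxy : x.1 < y.1) : h ((y.1 : ℕ) + 1) - 1 ≤ ‖wpt k h x - wpt k h y‖ := by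
  obtain ⟨i, a⟩ := x
  obtain ⟨j, b⟩ := y
  obtain ⟨i, hi⟩ := i
  obtain ⟨j, hj⟩ := j
  replace hxy : i < j := hxy
  obtain ⟨j, rfl⟩ : ∃ m, j = m + 1 := ⟨j - 1, by omega⟩
  have key : ∀ r : Fin 2,
      wpt k h (⟨i, hi⟩, a) r ≤ paritySum h j + 1 →
      wpt k h (⟨j + 1, hj⟩, b) r = paritySum h (j + 2) →
      h (j + 1 + 1) - 1 ≤ ‖wpt k h (⟨i, hi⟩, a) - wpt k h (⟨j + 1, hj⟩, b)‖ := by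
    intro r h1 h2
    have h3 := PiLp.norm_apply_le (wpt k h (⟨i, hi⟩, a) - wpt k h (⟨j + 1, hj⟩, b)) r
    rw [PiLp.sub_apply, Real.norm_eq_abs, h2] at h3
    have h4 : paritySum h (j + 2) = paritySum h j + h (j + 2) := rfl
    have h5 := neg_abs_le (wpt k h (⟨i, hi⟩, a) r - paritySum h (j + 2))
    rw [show j + 1 + 1 = j + 2 from rfl]
    linarith
  obtain ⟨io, ie⟩ := planarP_bounds hh i
  obtain ⟨jo, je⟩ := planarP_bounds hh (j + 1)
  have hj0 := paritySum_nonneg hh j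
  have mono : ∀ n, n ≤ j → n % 2 = j % 2 → paritySum h n ≤ paritySum h j := by
    intro n h1 h2
    have := paritySum_le_add_two_mul hh n ((j - n) / 2)
    rwa [show n + 2 * ((j - n) / 2) = j by omega] at this
  rcases Nat.mod_two_eq_zero_or_one (j + 2) with hj' | hj'
  · obtain ⟨b1, b2, -⟩ := je hj'
    apply key 0
    · rcases Nat.mod_two_eq_zero_or_one (i + 1) with hi' | hi'
      · obtain ⟨a1, a2, -⟩ := ie hi'
        have := mono (i + 1) (by omega) (by omega)
        dsimp only [wpt]
        split_ifs <;> simp only [toE2_apply_zero] <;> linarith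
      · obtain ⟨-, -, -, a4, -, a6⟩ := io hi'
        have := mono i (by omega) (by omega)
        dsimp only [wpt]
        split_ifs <;> simp only [toE2_apply_zero] <;> linarith
    · dsimp only [wpt]
      split_ifs <;> simpa only [toE2_apply_zero]
  · obtain ⟨b1, b2, -⟩ := jo hj'
    apply key 1
    · rcases Nat.mod_two_eq_zero_or_one (i + 1) with hi' | hi'
      · obtain ⟨-, -, -, a4, -, a6⟩ := ie hi'
        have := mono i (by omega) (by omega)
        dsimp only [wpt]
        split_ifs <;> simp only [toE2_apply_one] <;> linarith
      · obtain ⟨a1, a2, -⟩ := io hi'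
        have := mono (i + 1) (by omega) (by omega)
        dsimp only [wpt]
        split_ifs <;> simp only [toE2_apply_one] <;> linarith
    · dsimp only [wpt]
      split_ifs <;> simpa only [toE2_apply_one]

lemma wCanonical_isIdxPartition (k : ℕ) : IsIdxPartition k (wCanonical k) := by
  refine ⟨?_, ?_, ?_⟩
  · exact Finset.card_image_le.trans (by simp)
  · intro S hS
    obtain ⟨i, -, rfl⟩ := Finset.mem_image.1 hS
    exact ⟨(i, 0), by simp⟩
  · intro x
    refine ⟨Finset.univ.filter fun y => y.1 = x.1, ⟨?_, by simp⟩, ?_⟩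
    · exact Finset.mem_image_of_mem _ (Finset.mem_univ x.1)
    · rintro S ⟨hS, hx⟩
      obtain ⟨i, -, rfl⟩ := Finset.mem_image.1 hS
      rw [(Finset.mem_filter.1 hx).2]

/-- A partition other than the canonical one puts points of different index together. -/
lemma IsIdxPartition.exists_fst_lt {k : ℕ} {P : Finset (Finset (Fin k × Fin 2))}
    (hP : IsIdxPartition k P) (hne : P ≠ wCanonical k) :
    ∃ S ∈ P, ∃ x ∈ S, ∃ y ∈ S, x.1 < y.1 := by
  obtain ⟨hcard, -, hpart⟩ := hP
  by_contra! hcon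
  have hsame : ∀ S ∈ P, ∀ x ∈ S, ∀ y ∈ S, x.1 = y.1 := fun S hS x hx y hy =>
    le_antisymm (hcon S hS y hy x hx) (hcon S hS x hx y hy)
  choose f hf _ using fun i : Fin k => (hpart (i, 0)).exists
  have hmem : ∀ i, (i, 0) ∈ f i := by assumption
  have hinj : Function.Injective f := by
    intro i j hij
    exact hsame _ (hf i) _ (hmem i) (j, 0) (hij ▸ hmem j)
  have himage : Finset.univ.image f = P := by
    apply Finset.eq_of_subset_of_card_le
    · intro S hS
      obtain ⟨i, -, rfl⟩ := Finset.mem_image.1 hS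
      exact hf i
    · rw [Finset.card_image_of_injective _ hinj]
      simpa using hcard
  apply hne
  rw [← himage, wCanonical]
  refine Finset.image_congr fun i _ => ?_
  ext x
  simp only [Finset.mem_filter, Finset.mem_univ, true_and]
  refine ⟨fun hx => hsame _ (hf i) _ hx _ (hmem i), ?_⟩
  rintro rfl
  obtain ⟨S, hS, hx⟩ := (hpart x).exists
  rw [← himage] at hS
  obtain ⟨j, -, rfl⟩ := Finset.mem_image.1 hS
  rwa [hsame _ (hf j) _ hx _ (hmem j)]

lemma wCostMedian_pair_le {k : ℕ} {h w : ℕ → ℝ} (hw : ∀ i, 0 ≤ w i)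
    {P : Finset (Finset (Fin k × Fin 2))} {S : Finset (Fin k × Fin 2)} (hS : S ∈ P)
    {x y : Fin k × Fin 2} (hx : x ∈ S) (hy : y ∈ S) (hxy : x ≠ y)
    (hwxy : w ((y.1 : ℕ) + 1) ≤ w ((x.1 : ℕ) + 1)) :
    w ((y.1 : ℕ) + 1) * ‖wpt k h x - wpt k h y‖ ≤ wCostMedian k h w P := by
  have hterm : ∀ (c : EuclideanSpace ℝ (Fin 2)) (z : Fin k × Fin 2),
      0 ≤ w ((z.1 : ℕ) + 1) * ‖wpt k h z - c‖ := fun c z => mul_nonneg (hw _) (norm_nonneg _)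
  refine le_trans ?_ (Finset.single_le_sum (fun T _ => ?_) hS)
  · refine le_ciInf fun c => ?_
    calc w ((y.1 : ℕ) + 1) * ‖wpt k h x - wpt k h y‖
        ≤ w ((y.1 : ℕ) + 1) * (‖wpt k h x - c‖ + ‖wpt k h y - c‖) := by
          have := norm_sub_le_norm_sub_add_norm_sub (wpt k h x) c (wpt k h y)
          rw [norm_sub_rev c] at this
          exact mul_le_mul_of_nonneg_left this (hw _)
      _ ≤ w ((x.1 : ℕ) + 1) * ‖wpt k h x - c‖ + w ((y.1 : ℕ) + 1) * ‖wpt k h y - c‖ := by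
          rw [mul_add]
          gcongr
      _ = ∑ z ∈ {x, y}, w ((z.1 : ℕ) + 1) * ‖wpt k h z - c‖ := by rw [Finset.sum_pair hxy]
      _ ≤ _ := Finset.sum_le_sum_of_subset_of_nonneg
          (by simp [Finset.insert_subset_iff, hx, hy]) fun z _ _ => hterm c z
  · exact Real.iInf_nonneg fun c => Finset.sum_nonneg fun z _ => hterm c z

lemma wCostMedian_wCanonical_le {k : ℕ} {h w : ℕ → ℝ} (hh : ∀ i, 0 ≤ h i) (hw : ∀ i, 0 ≤ w i)
    {b : ℝ} (hb : 0 ≤ b) (hwb : ∀ n < k, w (n + 1) * (paritySum h n + 1 + (n + 1)) ≤ b) :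
    wCostMedian k h w (wCanonical k) ≤ k * b := by
  have hle : ∀ S ∈ wCanonical k, (⨅ c : EuclideanSpace ℝ (Fin 2),
      ∑ x ∈ S, w ((x.1 : ℕ) + 1) * ‖wpt k h x - c‖) ≤ b := by
    intro S hS
    obtain ⟨i, -, rfl⟩ := Finset.mem_image.1 hS
    refine (ciInf_le ⟨0, ?_⟩ (toE2 (planarP h (i + 1)).2)).trans ?_
    · rintro _ ⟨c, rfl⟩
      exact Finset.sum_nonneg fun z _ => mul_nonneg (hw _) (norm_nonneg _)
    · have hfib : (Finset.univ.filter fun x : Fin k × Fin 2 => x.1 = i) = {(i, 0), (i, 1)} := by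
        ext ⟨j, a⟩
        fin_cases a <;> simp
      rw [hfib, Finset.sum_pair (by simp)]
      refine le_trans ?_ (hwb i i.2)
      simpa [wpt] using mul_le_mul_of_nonneg_left (norm_planarP_sub_le hh i) (hw (i + 1))
  refine (Finset.sum_le_card_nsmul _ _ b hle).trans ?_
  rw [nsmul_eq_mul]
  gcongr
  exact (wCanonical_isIdxPartition k).1

/-- STATEMENT: the canonical partition `C = (C_1, …, C_k)` of `X(w, h)` is optimal for the
weighted k-median objective, and any other partition into at most `k` clusters costs at least
`p(2k)` times as much. -/
theorem stmt_11 (k : ℕ) (hk : 3 ≤ k) (p : ℕ → ℕ) :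
    ∃ h w : ℕ → ℝ,
      (∀ i, 1 ≤ i → i ≤ k → 0 < h i) ∧ (∀ i, 1 ≤ i → i ≤ k → 0 < w i) ∧
      IsIdxPartition k (wCanonical k) ∧
      (∀ P, IsIdxPartition k P → wCostMedian k h w (wCanonical k) ≤ wCostMedian k h w P) ∧
      ∀ P, IsIdxPartition k P → P ≠ wCanonical k →
        (p (2 * k) : ℝ) * wCostMedian k h w (wCanonical k) ≤ wCostMedian k h w P := by
  set q : ℝ := (p (2 * k) : ℝ)
  have hq0 : 0 ≤ q := Nat.cast_nonneg _
  have hk3 : (3 : ℝ) ≤ k := by exact_mod_cast hk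
  set B : ℝ := 4 * k ^ 2 * (q + 1) with hB
  have hB2 : 2 ≤ B := by nlinarith [mul_nonneg (sq_nonneg (k : ℝ)) hq0]
  have hB0 : 0 < B := by linarith
  let h : ℕ → ℝ := fun i => B ^ i
  let w : ℕ → ℝ := fun i => (B ^ i)⁻¹
  have hh : ∀ i, 0 < h i := fun i => by positivity
  have hw : ∀ i, 0 < w i := fun i => by positivity
  have hcanon : (q + 1) * wCostMedian k h w (wCanonical k) ≤ 1 / 2 := by
    have hc : wCostMedian k h w (wCanonical k) ≤ k * (2 * k / B) := by
      refine wCostMedian_wCanonical_le (fun i => (hh i).le) (fun i => (hw i).le) (by positivity) ?_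
      intro n hn
      have hnk : (n : ℝ) + 1 ≤ k := by exact_mod_cast hn
      have h1 : paritySum h n ≤ n * B ^ n := paritySum_pow_le (by linarith) n
      have h2 : 1 ≤ B ^ n := one_le_pow₀ (by linarith)
      have hn0 : (0 : ℝ) ≤ n := n.cast_nonneg
      have h3 : paritySum h n + 1 + (n + 1) ≤ 2 * k * B ^ n := by
        nlinarith [mul_le_mul_of_nonneg_right hnk (by linarith : 0 ≤ B ^ n)]
      calc w (n + 1) * (paritySum h n + 1 + (n + 1))
          ≤ (B ^ (n + 1))⁻¹ * (2 * k * B ^ n) := mul_le_mul_of_nonneg_left h3 (hw _).le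
        _ = 2 * k / B := by
          rw [pow_succ]
          field_simp
    calc (q + 1) * wCostMedian k h w (wCanonical k)
        ≤ (q + 1) * (k * (2 * k / B)) := by gcongr
      _ = 1 / 2 := by
        rw [hB]
        field_simp
        norm_num
  have hcanon0 : 0 ≤ wCostMedian k h w (wCanonical k) :=
    Finset.sum_nonneg fun S _ => Real.iInf_nonneg fun c => Finset.sum_nonneg fun z _ =>
      mul_nonneg (hw _).le (norm_nonneg _)
  have hother : ∀ P, IsIdxPartition k P → P ≠ wCanonical k → 1 / 2 ≤ wCostMedian k h w P := by
    intro P hP hne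
    obtain ⟨S, hS, x, hx, y, hy, hxy⟩ := hP.exists_fst_lt hne
    refine le_trans ?_ (wCostMedian_pair_le (h := h) (fun i => (hw i).le) hS hx hy ?_ ?_)
    · have h1 := le_norm_wpt_sub (fun i => (hh i).le) hxy
      have h2 : 2 ≤ h (y.1 + 1) :=
        hB2.trans (le_self_pow₀ (by linarith) (Nat.succ_ne_zero _))
      calc (1 / 2 : ℝ) = w (y.1 + 1) * (h (y.1 + 1) / 2) := by
            have := (hh (y.1 + 1)).ne'
            change 1 / 2 = (h (y.1 + 1))⁻¹ * (h (y.1 + 1) / 2)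
            field_simp
        _ ≤ _ := mul_le_mul_of_nonneg_left (by linarith) (hw _).le
    · rintro rfl
      exact lt_irrefl _ hxy
    · exact inv_anti₀ (hh _) (pow_le_pow_right₀ (by linarith) (by simpa using hxy.le))
  refine ⟨h, w, fun i _ _ => hh i, fun i _ _ => hw i, wCanonical_isIdxPartition k, ?_, ?_⟩
  · intro P hP
    rcases eq_or_ne P (wCanonical k) with rfl | hne
    · exact le_rfl
    · nlinarith [hother P hP hne]
  · intro P hP hne
    linarith [hother P hP hne]

end
end

section
/- For every integer k ≥ 3, every partition of Y_k into at most k clusters other than the partition C = (C_1,…,C_k) has k-center cost at least 1, whereas the partition C has k-center cost 1/2. -/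
noncomputable section

attribute [local instance] Classical.propDecidable

/-- The offset of the `a`-th point of a cluster of `Y_k` from the center of the cluster. -/
def Yoffset : Fin 4 → ℝ × ℝ := ![(0, -0.5), (-0.5, 0), (0, 0.5), (0.5, 0)]

@[simp] theorem Yoffset_zero : Yoffset 0 = (0, -0.5) := rfl

@[simp] theorem Yoffset_one : Yoffset 1 = (-0.5, 0) := rfl

@[simp] theorem Yoffset_two : Yoffset 2 = (0, 0.5) := rfl

@[simp] theorem Yoffset_three : Yoffset 3 = (0.5, 0) := rfl

/-- The center of the cluster `C_i` of `Y_k`. -/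
def Ycenter : ℕ → ℝ × ℝ
  | 0 => (0, 0)
  | 1 => (-1, 0.5)
  | 2 => (1, 0.5)
  | 3 => (0, 2.5)
  | 4 => (3, 1.5)
  | i + 5 => Ycenter (i + 3) + (2, 2)

/-- The index of a point of `C_i` that is far from (almost) all other clusters. -/
def Yrep (i : ℕ) : Fin 4 := if i = 1 then 1 else if i = 2 then 0 else 2

theorem Ypt_eq_center_add_offset (i : ℕ) (a : Fin 4) :
    Ypt (i + 1) a = Ycenter (i + 1) + Yoffset a := by
  induction i using Nat.strong_induction_on with
  | _ i ih =>
    match i with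
    | 0 => fin_cases a <;> norm_num [Ypt, Ycenter, Yoffset, Ybase1]
    | 1 => fin_cases a <;> norm_num [Ypt, Ycenter, Yoffset, Ybase2]
    | 2 => fin_cases a <;> norm_num [Ypt, Ycenter, Yoffset, Ybase1]
    | 3 => fin_cases a <;> norm_num [Ypt, Ycenter, Yoffset, Ybase2]
    | i + 4 =>
      change Ypt (i + 3) a + (2, 2) = Ycenter (i + 3) + (2, 2) + Yoffset a
      rw [ih (i + 2) (by omega)]
      abel

theorem Ycenter_odd (m : ℕ) : Ycenter (2 * m + 3) = (2 * (m : ℝ), 2 * (m : ℝ) + 2.5) := by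
  induction m with
  | zero => norm_num [Ycenter]
  | succ m ih =>
    change Ycenter (2 * m + 3) + (2, 2) = _
    rw [ih]
    ext <;> push_cast <;> simp only [Prod.fst_add, Prod.snd_add] <;> ring

theorem Ycenter_even (m : ℕ) :
    Ycenter (2 * m + 4) = (2 * (m : ℝ) + 3, 2 * (m : ℝ) + 1.5) := by
  induction m with
  | zero => norm_num [Ycenter]
  | succ m ih =>
    change Ycenter (2 * m + 4) + (2, 2) = _
    rw [ih]
    ext <;> push_cast <;> simp only [Prod.fst_add, Prod.snd_add] <;> ring

theorem eq_zero_or_one_or_even_or_odd (i : ℕ) :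
    i = 0 ∨ i = 1 ∨ (∃ m, i = 2 * m + 2) ∨ ∃ m, i = 2 * m + 3 := by
  rcases Nat.even_or_odd' i with ⟨m, rfl | rfl⟩
  · rcases m with _ | m
    · simp
    · exact Or.inr (Or.inr (Or.inl ⟨m, by ring⟩))
  · rcases m with _ | m
    · simp
    · exact Or.inr (Or.inr (Or.inr ⟨m, by ring⟩))

theorem fin_four_cases (a : Fin 4) : a = 0 ∨ a = 1 ∨ a = 2 ∨ a = 3 := by
  omega

theorem natCast_add_one_le_or {m n : ℕ} (h : m ≠ n) : (m : ℝ) + 1 ≤ n ∨ (n : ℝ) + 1 ≤ m := by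
  norm_cast
  omega

theorem Ycenter_separated {i j : ℕ} (h : i ≠ j) :
    1 < ((Ycenter (i + 1)).1 - (Ycenter (j + 1)).1) ^ 2 +
      ((Ycenter (i + 1)).2 - (Ycenter (j + 1)).2) ^ 2 := by
  have hcast (n : ℕ) : (0 : ℝ) ≤ n := n.cast_nonneg
  rcases eq_zero_or_one_or_even_or_odd i with rfl | rfl | ⟨m, rfl⟩ | ⟨m, rfl⟩ <;>
  rcases eq_zero_or_one_or_even_or_odd j with rfl | rfl | ⟨n, rfl⟩ | ⟨n, rfl⟩ <;>
  simp only [Ycenter_odd, Ycenter_even, Nat.reduceAdd, add_assoc, Ycenter]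
  case inl.inl | inr.inl.inr.inl => exact absurd rfl h
  case inr.inr.inl.inr.inr.inl | inr.inr.inr.inr.inr.inr =>
    rcases natCast_add_one_le_or (m := m) (n := n) (by omega) with h | h <;> nlinarith
  case inr.inr.inl.inr.inr.inr =>
    nlinarith [sq_nonneg (2 * (m : ℝ) - (2 * (n : ℝ) + 3) + (2 * m + 2.5 - (2 * n + 1.5)))]
  case inr.inr.inr.inr.inr.inl =>
    nlinarith [sq_nonneg (2 * (n : ℝ) - (2 * (m : ℝ) + 3) + (2 * n + 2.5 - (2 * m + 1.5)))]
  all_goals first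
    | nlinarith [hcast m]
    | nlinarith [hcast n]
    | norm_num

theorem Ypt_injective {i j : ℕ} {a b : Fin 4} (h : Ypt (i + 1) a = Ypt (j + 1) b) :
    i = j ∧ a = b := by
  rw [Ypt_eq_center_add_offset, Ypt_eq_center_add_offset] at h
  have hij : i = j := by
    by_contra hij
    have hsep := Ycenter_separated hij
    have h1 := congrArg Prod.fst h
    have h2 := congrArg Prod.snd h
    simp only [Prod.fst_add, Prod.snd_add] at h1 h2
    rw [show (Ycenter (i + 1)).1 - (Ycenter (j + 1)).1 = (Yoffset b).1 - (Yoffset a).1 by linarith,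
      show (Ycenter (i + 1)).2 - (Ycenter (j + 1)).2 = (Yoffset b).2 - (Yoffset a).2 by linarith]
      at hsep
    rcases fin_four_cases a with rfl | rfl | rfl | rfl <;>
    rcases fin_four_cases b with rfl | rfl | rfl | rfl <;>
    norm_num at hsep
  subst hij
  refine ⟨rfl, ?_⟩
  have h := add_left_cancel h
  rcases fin_four_cases a with rfl | rfl | rfl | rfl <;>
  rcases fin_four_cases b with rfl | rfl | rfl | rfl <;>
  first | rfl | norm_num at h

theorem Yrep_far {i j : ℕ} (a : Fin 4) (h : i ≠ j) (h' : ¬(i = 1 ∧ j = 0 ∧ a = 3)) :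
    4 ≤ ((Ypt (i + 1) (Yrep (i + 1))).1 - (Ypt (j + 1) a).1) ^ 2 +
      ((Ypt (i + 1) (Yrep (i + 1))).2 - (Ypt (j + 1) a).2) ^ 2 := by
  have hcast (n : ℕ) : (0 : ℝ) ≤ n := n.cast_nonneg
  simp only [Ypt_eq_center_add_offset]
  rcases eq_zero_or_one_or_even_or_odd i with rfl | rfl | ⟨m, rfl⟩ | ⟨m, rfl⟩ <;>
  rcases eq_zero_or_one_or_even_or_odd j with rfl | rfl | ⟨n, rfl⟩ | ⟨n, rfl⟩ <;>
  simp only [Yrep, Ycenter_odd, Ycenter_even, zero_add, Nat.reduceAdd, Nat.reduceEqDiff,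
    if_true, if_false, add_assoc, Ycenter, Prod.fst_add, Prod.snd_add]
  case inl.inl | inr.inl.inr.inl => exact absurd rfl h
  case inr.inl.inl =>
    rcases fin_four_cases a with rfl | rfl | rfl | rfl <;> norm_num at *
  case inr.inr.inl.inr.inr.inl | inr.inr.inr.inr.inr.inr =>
    rcases natCast_add_one_le_or (m := m) (n := n) (by omega) with h | h <;>
    rcases fin_four_cases a with rfl | rfl | rfl | rfl <;> norm_num <;> nlinarith
  case inr.inr.inl.inr.inr.inr =>
    rcases fin_four_cases a with rfl | rfl | rfl | rfl <;> norm_num <;>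
    nlinarith [sq_nonneg (4 * (m : ℝ) - 4 * n - 2), sq_nonneg (4 * (m : ℝ) - 4 * n - 1),
      sq_nonneg (4 * (m : ℝ) - 4 * n - 1.5)]
  case inr.inr.inr.inr.inr.inl =>
    rcases fin_four_cases a with rfl | rfl | rfl | rfl <;> norm_num <;>
    nlinarith [sq_nonneg (4 * (m : ℝ) - 4 * n + 2), sq_nonneg (4 * (m : ℝ) - 4 * n + 1),
      sq_nonneg (4 * (m : ℝ) - 4 * n + 2.5)]
  all_goals
    rcases fin_four_cases a with rfl | rfl | rfl | rfl <;> norm_num <;>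
    first | nlinarith [hcast m] | nlinarith [hcast n]

theorem dist_toE2 (p q : ℝ × ℝ) :
    dist (toE2 p) (toE2 q) = √((p.1 - q.1) ^ 2 + (p.2 - q.2) ^ 2) := by
  simp [EuclideanSpace.dist_eq, toE2, Fin.sum_univ_two, Real.dist_eq, sq_abs]

theorem toE2_injective : Function.Injective toE2 := by
  intro p q h
  have h0 := congrArg (fun x : EuclideanSpace ℝ (Fin 2) => x 0) h
  have h1 := congrArg (fun x : EuclideanSpace ℝ (Fin 2) => x 1) h
  simp [toE2] at h0 h1
  exact Prod.ext h0 h1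

theorem mem_Ycluster {i : ℕ} {x : EuclideanSpace ℝ (Fin 2)} :
    x ∈ Ycluster i ↔ ∃ a, toE2 (Ypt i a) = x := by
  simp only [Ycluster, Multiset.mem_map, Finset.mem_val, Finset.mem_univ, true_and]

theorem mem_Yset {k : ℕ} {x : EuclideanSpace ℝ (Fin 2)} :
    x ∈ Yset k ↔ ∃ i < k, ∃ a, toE2 (Ypt (i + 1) a) = x := by
  simp only [Yset, Ypartition, ← mem_Ycluster]
  change x ∈ Finset.sum _ _ ↔ _
  simp [Multiset.mem_sum]

theorem nodup_Ycluster (i : ℕ) : (Ycluster (i + 1)).Nodup :=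
  Finset.univ.nodup.map fun _ _ h => (Ypt_injective (toE2_injective h)).2

theorem nodup_Yset (k : ℕ) : (Yset k).Nodup := by
  change (Multiset.bind (Finset.range k).val fun i => Ycluster (i + 1)).Nodup
  rw [Multiset.nodup_bind]
  refine ⟨fun i _ => nodup_Ycluster i, ?_⟩
  refine (Finset.range k).nodup.pairwise fun i _ j _ hij => ?_
  rw [Function.onFun, Multiset.disjoint_left]
  intro x hi hj
  obtain ⟨a, rfl⟩ := mem_Ycluster.1 hi
  obtain ⟨b, hb⟩ := mem_Ycluster.1 hj
  exact hij (Ypt_injective (toE2_injective hb)).1.symm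

theorem bddAbove_image_mem {α : Type*} (f : α → ℝ) (S : Multiset α) :
    BddAbove (f '' {x | x ∈ S}) := by
  classical
  have : {x | x ∈ S}.Finite := by
    convert S.toFinset.finite_toSet using 1
    ext; simp
  exact (this.image f).bddAbove

/-- In a cluster of `1`-center cost less than `r`, points have distance less than `2 * r`. -/
theorem dist_lt_of_costCenter1_lt {d : ℕ} {S : Multiset (EuclideanSpace ℝ (Fin d))} {r : ℝ}
    (h : costCenter1 S < r) {x y : EuclideanSpace ℝ (Fin d)} (hx : x ∈ S) (hy : y ∈ S) :
    dist x y < 2 * r := by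
  obtain ⟨c, hc⟩ := exists_lt_of_ciInf_lt h
  have key : ∀ z ∈ S, dist z c < r := fun z hz => by
    rw [dist_eq_norm]
    exact (le_csSup (bddAbove_image_mem _ S) ⟨z, hz, rfl⟩).trans_lt hc
  linarith [dist_triangle_right x y c, key x hx, key y hy]

theorem costCenter1_le {d : ℕ} {S : Multiset (EuclideanSpace ℝ (Fin d))} {r : ℝ}
    (hr : 0 ≤ r) (c : EuclideanSpace ℝ (Fin d)) (h : ∀ x ∈ S, dist x c ≤ r) :
    costCenter1 S ≤ r := by
  refine (ciInf_le ⟨0, ?_⟩ c).trans (Real.sSup_le ?_ hr)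
  · rintro _ ⟨c, rfl⟩
    refine Real.sSup_nonneg ?_
    rintro _ ⟨x, -, rfl⟩
    exact norm_nonneg _
  · rintro _ ⟨x, hx, rfl⟩
    simpa [dist_eq_norm] using h x hx

theorem costCenter1_Ycluster (i : ℕ) : costCenter1 (Ycluster (i + 1)) = 1 / 2 := by
  refine le_antisymm (costCenter1_le (by norm_num) (toE2 (Ycenter (i + 1))) ?_) ?_
  · intro x hx
    obtain ⟨a, rfl⟩ := mem_Ycluster.1 hx
    rw [dist_toE2, Ypt_eq_center_add_offset]
    refine Real.sqrt_le_iff.2 ⟨by norm_num, ?_⟩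
    fin_cases a <;> norm_num [Yoffset]
  · by_contra! h
    have := dist_lt_of_costCenter1_lt h (mem_Ycluster.2 ⟨0, rfl⟩) (mem_Ycluster.2 ⟨2, rfl⟩)
    rw [dist_toE2, Ypt_eq_center_add_offset, Ypt_eq_center_add_offset] at this
    norm_num at this

theorem costCenter_Ypartition {k : ℕ} (hk : 0 < k) : costCenter (Ypartition k) = 1 / 2 := by
  have : costCenter1 '' {S | S ∈ Ypartition k} = {1 / 2} := by
    ext r
    simp only [Ypartition, Set.mem_image, Set.mem_ofPred_eq, Multiset.mem_map, Finset.mem_val,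
      Finset.mem_range, Set.mem_singleton_iff]
    constructor
    · rintro ⟨_, ⟨i, -, rfl⟩, rfl⟩
      exact costCenter1_Ycluster i
    · rintro rfl
      exact ⟨_, ⟨0, hk, rfl⟩, costCenter1_Ycluster 0⟩
  rw [costCenter, this, csSup_singleton]

/-- A clustering of `Y_k` in which points of a common cluster have distance less than `2`
is the partition `C`. -/
theorem eq_Ypartition_of_dist_lt {k : ℕ} {P : Multiset (Multiset (EuclideanSpace ℝ (Fin 2)))}
    (hP : IsClustering (Yset k) k P) (hd : ∀ S ∈ P, ∀ x ∈ S, ∀ y ∈ S, dist x y < 2) :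
    P = Ypartition k := by
  obtain ⟨hsum, hcard, -⟩ := hP
  have hle : ∀ S ∈ P, S ≤ Yset k := fun S hS => hsum ▸ Multiset.single_le_sum
    (fun _ _ => zero_le) S hS
  have hex : ∀ i < k, ∀ a, ∃ S ∈ P, toE2 (Ypt (i + 1) a) ∈ S := fun i hi a => by
    have : toE2 (Ypt (i + 1) a) ∈ P.sum := hsum ▸ mem_Yset.2 ⟨i, hi, a, rfl⟩
    rw [← Multiset.join, Multiset.mem_join] at this
    exact this
  have hex' : ∀ i, ∃ S, i < k → S ∈ P ∧ toE2 (Ypt (i + 1) (Yrep (i + 1))) ∈ S := fun i => by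
    by_cases hi : i < k
    · obtain ⟨S, hS⟩ := hex i hi (Yrep (i + 1))
      exact ⟨S, fun _ => hS⟩
    · exact ⟨0, fun h => absurd h hi⟩
  choose S hS using hex'
  have hfar : ∀ i < k, ∀ j a, toE2 (Ypt (j + 1) a) ∈ S i →
      i = j ∨ i = 1 ∧ j = 0 ∧ a = 3 := fun i hi j a hj => by
    by_contra! h
    have h1 := hd _ (hS i hi).1 _ (hS i hi).2 _ hj
    rw [dist_toE2, Real.sqrt_lt' two_pos] at h1
    linarith [Yrep_far a h.1 fun h' => h.2 h'.1 h'.2.1 h'.2.2]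
  have hinj : ∀ i < k, ∀ j < k, S i = S j → i = j := fun i hi j hj hij => by
    rcases hfar i hi j _ (hij ▸ (hS j hj).2) with h | ⟨-, rfl, h⟩
    · exact h
    · simp [Yrep] at h
  have hPS : (Finset.range k).val.map S = P := by
    refine Multiset.eq_of_le_of_card_le ?_ (by simpa using hcard)
    refine (Multiset.le_iff_subset ?_).2 ?_
    · exact Multiset.Nodup.map_on
        (fun i hi j hj => hinj i (Finset.mem_range.1 hi) j (Finset.mem_range.1 hj))
        (Finset.range k).nodup
    · intro T hT
      obtain ⟨i, hi, rfl⟩ := Multiset.mem_map.1 hT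
      exact (hS i (Finset.mem_range.1 hi)).1
  have hcover : ∀ j < k, ∀ a, ∃ i < k, toE2 (Ypt (j + 1) a) ∈ S i := fun j hj a => by
    obtain ⟨T, hT, hmem⟩ := hex j hj a
    rw [← hPS] at hT
    obtain ⟨i, hi, rfl⟩ := Multiset.mem_map.1 hT
    exact ⟨i, Finset.mem_range.1 hi, hmem⟩
  have hfar' : ∀ i < k, ∀ j a, toE2 (Ypt (j + 1) a) ∈ S i → i = j := fun i hi j a hj => by
    rcases hfar i hi j a hj with h | ⟨rfl, rfl, rfl⟩
    · exact h
    · obtain ⟨i, hi', hmem⟩ := hcover 1 hi 3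
      obtain rfl : i = 1 := (hfar i hi' 1 3 hmem).elim id fun h => h.1
      have h1 := hd _ (hS 1 hi).1 _ hmem _ hj
      rw [dist_toE2, Real.sqrt_lt' two_pos] at h1
      rw [Ypt_eq_center_add_offset, Ypt_eq_center_add_offset] at h1
      norm_num [Ycenter] at h1
  rw [← hPS, Ypartition]
  refine Multiset.map_congr rfl fun i hi => ?_
  have hi := Finset.mem_range.1 hi
  refine (Multiset.Nodup.ext (Multiset.nodup_of_le (hle _ (hS i hi).1) (nodup_Yset k))
    (nodup_Ycluster i)).2 fun x => ⟨fun hx => ?_, fun hx => ?_⟩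
  · obtain ⟨j, -, a, rfl⟩ := mem_Yset.1 (Multiset.mem_of_le (hle _ (hS i hi).1) hx)
    obtain rfl := hfar' i hi j a hx
    exact mem_Ycluster.2 ⟨a, rfl⟩
  · obtain ⟨a, rfl⟩ := mem_Ycluster.1 hx
    obtain ⟨j, hj, hmem⟩ := hcover i hi a
    obtain rfl := hfar' j hj i a hmem
    exact hmem

/-- STATEMENT: every partition of `Y_k` into at most `k` clusters other than
`C = (C_1, …, C_k)` has k-center cost at least `1`, whereas `C` has k-center cost `1/2`. -/
theorem stmt_17 (k : ℕ) (hk : 3 ≤ k) :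
    (∀ P, IsClustering (Yset k) k P → P ≠ Ypartition k → 1 ≤ costCenter P) ∧
    costCenter (Ypartition k) = 1 / 2 := by
  refine ⟨fun P hP hne => ?_, costCenter_Ypartition (by omega)⟩
  by_contra! h
  refine hne (eq_Ypartition_of_dist_lt hP fun S hS x hx y hy => ?_)
  have hS' : costCenter1 S < 1 := (le_csSup (bddAbove_image_mem _ P) ⟨S, hS, rfl⟩).trans_lt h
  simpa using dist_lt_of_costCenter1_lt hS' hx hy

end
end
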